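/- For all integers j, k ≥ 0 and every t = q^{2α} ∈ (0,1): (B_{q,t} f_k)(q^{2j}) = (q²t;q²)_n · Σ_{r=0}^{∞} t^r q^{2r} [(q^{2r+2};q²)_{n−1} / (q²;q²)_{n−1}] · (p_r(Δ) δ_k)(j), the series on the right converging absolutely. (This is the asymptotic expansion of the q-Berezin transform in powers of t = q^{2α} with coefficients expressed through the q-Laplace–Beltrami operator, Proposition 5.5, for radial functions.) -/

import Mathlib

/-- The q²-shifted factorial `(a; q²)_m = ∏_{j=0}^{m-1} (1 − a q^{2j})` (complex). -/
noncomputable def qpochC (q : ℝ) (a : ℂ) (m : ℕ) : ℂ :=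
  ∏ j ∈ Finset.range m, (1 - a * (q : ℂ) ^ (2 * j))

/-- The q²-shifted factorial (real version). -/
noncomputable def qpochR (q a : ℝ) (m : ℕ) : ℝ :=
  ∏ j ∈ Finset.range m, (1 - a * q ^ (2 * j))

/-- The radial q-Berezin transform of the delta function `f_k`, evaluated at `q^{2j}`. -/
noncomputable def Brad (q t : ℝ) (n k j : ℕ) : ℝ :=
  t ^ (k + j) * q ^ (2 * k) * q ^ (2 * j * (n + 1)) *
    ∑ m ∈ Finset.range (min j k + 1),
      (t ^ (2 * m))⁻¹ * (q ^ (4 * m + 2 * m * n))⁻¹ * qpochR q (t * q ^ 2) (n + m) *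
        qpochR q (q ^ (2 * k - 2 * m + 2)) (n + m - 1) * qpochR q (t * q ^ (2 * n + 2)) m *
        qpochR q (q ^ (2 * j - 2 * m + 2)) m /
        (qpochR q (q ^ 2) (n + m - 1) * qpochR q (q ^ 2) m)

/-- The radial q-Laplace–Beltrami operator as a linear endomorphism of `ℕ → ℂ`. -/
noncomputable def DeltaOp (q : ℝ) (n : ℕ) : Module.End ℂ (ℕ → ℂ) where
  toFun g := fun j =>
    (q : ℂ) ^ 2 / (1 - (q : ℂ) ^ 2) ^ 2 *
      ((1 - (q : ℂ) ^ (2 * j)) * (if j = 0 then 0 else g (j - 1)) -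
        (1 + ((q : ℂ) ^ (2 * n))⁻¹ - 2 * (q : ℂ) ^ (2 * j)) * g j +
        (((q : ℂ) ^ (2 * n))⁻¹ - (q : ℂ) ^ (2 * j)) * g (j + 1))
  map_add' g h := by
    funext j
    simp only [Pi.add_apply]
    split <;> ring
  map_smul' c g := by
    funext j
    simp only [Pi.smul_apply, smul_eq_mul, RingHom.id_apply]
    split <;> ring

/-- The polynomial `p_r(x)` from the asymptotic expansion of the q-Berezin transform. -/
noncomputable def pBerPoly (q : ℝ) (n r : ℕ) : Polynomial ℂ :=
  ∑ l ∈ Finset.range (r + 1),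
    Polynomial.C (qpochC q (((q : ℂ) ^ (2 * r))⁻¹) l * (q : ℂ) ^ (2 * l) /
        (qpochC q ((q : ℂ) ^ (2 * n)) l * qpochC q ((q : ℂ) ^ 2) l)) *
      ∏ m ∈ Finset.range l,
        (Polynomial.C ((1 - (q : ℂ) ^ (2 * m)) * (1 - (q : ℂ) ^ (2 * m + 2 * n))) -
          Polynomial.C ((q : ℂ) ^ (2 * m + 2 * n - 2) * (1 - (q : ℂ) ^ 2) ^ 2) * Polynomial.X)

/-- Coefficients of the terminating basic hypergeometric series defining `p_r`, with `z = Q ^ r`. -/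
noncomputable def seriesCoeff (Q : ℂ) (n : ℕ) (z : ℂ) (l : ℕ) : ℂ :=
  ∏ i ∈ Finset.range l, (1 - Q ^ i / z) * Q / ((1 - Q ^ (n + i)) * (1 - Q ^ (i + 1)))

/-- The Newton-type basis in which `p_r` is expanded, with `y = 1 + Q ^ n + Q ^ (n-1) (1-Q)² x`. -/
noncomputable def seriesBasis (Q : ℂ) (n : ℕ) (y : ℂ) (l : ℕ) : ℂ :=
  ∏ m ∈ Finset.range l, (1 - Q ^ m * y + Q ^ (2 * m + n))

theorem seriesCoeff_mul_succ {Q z : ℂ} (n : ℕ) (hQ : Q ≠ 0) (hz : z ≠ 0) (l : ℕ) :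
    seriesCoeff Q n (z * Q) (l + 1) = seriesCoeff Q n z l *
      ((1 - 1 / (z * Q)) * Q / ((1 - Q ^ (n + l)) * (1 - Q ^ (l + 1)))) := by
  induction l with
  | zero => simp [seriesCoeff]
  | succ l ih =>
    rw [seriesCoeff, Finset.prod_range_succ, ← seriesCoeff, ih, seriesCoeff, seriesCoeff,
      Finset.prod_range_succ]
    have h : Q ^ (l + 1) / (z * Q) = Q ^ l / z := by field_simp; ring
    rw [h]
    ring

theorem seriesCoeff_div {Q z : ℂ} {n : ℕ} (hn : 1 ≤ n) (hQ : Q ≠ 0) (hz : z ≠ 0)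
    (h1 : ∀ i : ℕ, 1 - Q ^ (i + 1) ≠ 0) (l : ℕ) :
    (1 - z) * seriesCoeff Q n (z / Q) l =
      -z * seriesCoeff Q n z l * (1 - Q ^ l / z) := by
  have h := seriesCoeff_mul_succ (z := z / Q) n hQ (div_ne_zero hz hQ) l
  rw [div_mul_cancel₀ _ hQ] at h
  rw [seriesCoeff, Finset.prod_range_succ, ← seriesCoeff] at h
  have ha := h1 l
  obtain ⟨n, rfl⟩ := Nat.exists_eq_add_of_le' hn
  have hb := h1 (n + l)
  rw [show n + l + 1 = n + 1 + l by ring] at hb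
  field_simp at h ⊢
  linear_combination h

theorem sum_series_recurrence {Q z : ℂ} {n : ℕ} (hn : 1 ≤ n) (hQ : Q ≠ 0) (hz : z ≠ 0)
    (h1 : ∀ i : ℕ, 1 - Q ^ (i + 1) ≠ 0) (y : ℂ) (N : ℕ) :
    ∑ l ∈ Finset.range (N + 1), (y * seriesCoeff Q n z l
      - (1 - Q ^ n * z) * seriesCoeff Q n (z * Q) l - 2 * (Q ^ n * z) * seriesCoeff Q n z l
      - Q ^ n * ((1 - z) * seriesCoeff Q n (z / Q) l)) * seriesBasis Q n y l =
    -(seriesCoeff Q n z N * seriesBasis Q n y (N + 1) / Q ^ N) := by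
  induction N with
  | zero =>
    simp [seriesCoeff, seriesBasis]
    ring
  | succ N ih =>
    rw [Finset.sum_range_succ, ih, seriesCoeff_div hn hQ hz h1, seriesCoeff_mul_succ n hQ hz,
      show seriesBasis Q n y (N + 1 + 1) = seriesBasis Q n y (N + 1) *
        (1 - Q ^ (N + 1) * y + Q ^ (2 * (N + 1) + n)) from Finset.prod_range_succ _ _,
      show seriesCoeff Q n z (N + 1) = seriesCoeff Q n z N *
        ((1 - Q ^ N / z) * Q / ((1 - Q ^ (n + N)) * (1 - Q ^ (N + 1)))) from
        Finset.prod_range_succ _ _]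
    have ha := h1 N
    obtain ⟨n, rfl⟩ := Nat.exists_eq_add_of_le' hn
    have hb := h1 (n + N)
    rw [show n + N + 1 = n + 1 + N by ring] at hb
    generalize seriesBasis Q (n + 1) y (N + 1) = S
    generalize seriesCoeff Q (n + 1) z N = c
    field_simp
    ring

theorem seriesCoeff_eq_zero {Q : ℂ} (n : ℕ) (hQ : Q ≠ 0) {r l : ℕ} (h : r < l) :
    seriesCoeff Q n (Q ^ r) l = 0 :=
  Finset.prod_eq_zero (Finset.mem_range.2 h) (by simp [hQ])

/-- The `Q`-hypergeometric factor of the `m`-th summand of the Berezin kernel,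
with `y = Q ^ j` and `w = Q ^ k`. -/
noncomputable def kernelProd (Q : ℂ) (n : ℕ) (w y : ℂ) (m : ℕ) : ℂ :=
  ∏ i ∈ Finset.range m,
    (1 - y / Q ^ i) * (1 - w / Q ^ i) / ((1 - Q ^ (n + i)) * (1 - Q ^ (i + 1)) * Q ^ (n + 2))

theorem kernelProd_succ (Q : ℂ) (n : ℕ) (w y : ℂ) (m : ℕ) :
    kernelProd Q n w y (m + 1) = kernelProd Q n w y m * ((1 - y / Q ^ m) * (1 - w / Q ^ m) /
      ((1 - Q ^ (n + m)) * (1 - Q ^ (m + 1)) * Q ^ (n + 2))) :=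
  Finset.prod_range_succ _ _

theorem kernelProd_mul {Q : ℂ} (n : ℕ) (hQ : Q ≠ 0) (w y : ℂ) (m : ℕ) :
    kernelProd Q n w (y * Q) (m + 1) = kernelProd Q n w y m * ((1 - y * Q) * (1 - w / Q ^ m) /
      ((1 - Q ^ (n + m)) * (1 - Q ^ (m + 1)) * Q ^ (n + 2))) := by
  induction m with
  | zero => simp [kernelProd]
  | succ m ih =>
    have h : y * Q / Q ^ (m + 1) = y / Q ^ m := by field_simp; ring
    rw [kernelProd_succ, ih, kernelProd_succ, h]
    ring

theorem kernelProd_div (Q : ℂ) (n : ℕ) (w y : ℂ) (m : ℕ) :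
    (1 - y) * kernelProd Q n w (y / Q) m = (1 - y / Q ^ m) * kernelProd Q n w y m := by
  induction m with
  | zero => simp [kernelProd]
  | succ m ih =>
    have h : y / Q / Q ^ m = y / Q ^ (m + 1) := by rw [div_div, pow_succ']
    rw [kernelProd_succ, ← mul_assoc, ih, kernelProd_succ, h]
    ring

theorem kernelProd_eq_zero_left {Q : ℂ} (n : ℕ) (hQ : Q ≠ 0) (w : ℂ) {j m : ℕ} (h : j < m) :
    kernelProd Q n w (Q ^ j) m = 0 :=
  Finset.prod_eq_zero (Finset.mem_range.2 h) (by simp [hQ])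

/-- The squared shifted factorial `(tQ^{n+1}; Q)_m²` together with its power of `t`. -/
noncomputable def kernelPoch (Q : ℂ) (n : ℕ) (t : ℂ) (m : ℕ) : ℂ :=
  (∏ i ∈ Finset.range m, (1 - t * Q ^ (n + 1 + i))) ^ 2 / t ^ (2 * m)

theorem kernelPoch_succ (Q : ℂ) (n : ℕ) (t : ℂ) (m : ℕ) :
    kernelPoch Q n t (m + 1) = kernelPoch Q n t m * ((1 - t * Q ^ (n + 1 + m)) ^ 2 / t ^ 2) := by
  simp only [kernelPoch, Finset.prod_range_succ, mul_add, pow_add]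
  ring

theorem kernelPoch_mul {Q : ℂ} (n : ℕ) (t : ℂ) (m : ℕ) :
    (1 - t * Q ^ (n + 1)) ^ 2 * kernelPoch Q n (t * Q) m =
      kernelPoch Q n t m * ((1 - t * Q ^ (n + 1 + m)) ^ 2 / Q ^ (2 * m)) := by
  have h := Finset.prod_range_succ' (fun i => 1 - t * Q ^ (n + 1 + i)) m
  rw [Finset.prod_range_succ] at h
  have h2 : ∀ i, t * Q * Q ^ (n + 1 + i) = t * Q ^ (n + 1 + (i + 1)) := fun i => by ring
  simp only [kernelPoch, h2, mul_pow]
  simp only [add_zero] at h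
  rw [mul_div_assoc', ← mul_pow, mul_comm (1 - t * Q ^ (n + 1)), ← h]
  ring

/-- Telescoping form of the recurrence in `j` satisfied by the Berezin kernel. -/
theorem kernel_sum_recurrence {Q t : ℂ} {n : ℕ} (hn : 1 ≤ n) (hQ : Q ≠ 0) (ht : t ≠ 0)
    (h1 : ∀ i : ℕ, 1 - Q ^ (i + 1) ≠ 0) (w y : ℂ) (N : ℕ) :
    ∑ m ∈ Finset.range (N + 1),
      ((1 - Q ^ n * y) * (t * Q ^ (n + 1) * kernelPoch Q n t m * kernelProd Q n w (y * Q) m)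
      + 2 * (Q ^ n * y) * (kernelPoch Q n t m * kernelProd Q n w y m)
      + Q ^ n * ((1 - y) * kernelProd Q n w (y / Q) m) *
        (kernelPoch Q n t m / (t * Q ^ (n + 1)))
      - (t * Q ^ (n + 1) + 1 / (t * Q)) * (kernelPoch Q n t m * kernelProd Q n w y m)
      + w * y / (t * Q) * ((1 - t * Q ^ (n + 1)) ^ 2 * kernelPoch Q n (t * Q) m)
         * kernelProd Q n w y m) =
    - (y / Q ^ N * (1 - w / Q ^ N) / Q * t * kernelPoch Q n t (N + 1) * kernelProd Q n w y N) := by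
  induction N with
  | zero =>
    simp [kernelProd, kernelPoch]
    field_simp
    ring
  | succ N ih =>
    rw [Finset.sum_range_succ, ih, kernelProd_div, kernelPoch_mul, kernelProd_mul n hQ,
      kernelPoch_succ _ _ _ (N + 1), kernelProd_succ Q n w y N]
    have ha := h1 N
    obtain ⟨n, rfl⟩ := Nat.exists_eq_add_of_le' hn
    have hb := h1 (n + N)
    rw [show n + N + 1 = n + 1 + N by ring] at hb
    generalize kernelPoch Q (n + 1) t (N + 1) = S
    generalize kernelProd Q (n + 1) w y N = c
    field_simp
    ring

/-- The Berezin kernel divided by `(Qt; Q)_n`. -/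
noncomputable def berezinKernel (Q : ℂ) (n k : ℕ) (t : ℂ) (j : ℕ) : ℂ :=
  (∏ i ∈ Finset.range (n - 1), (1 - Q ^ (k + 1 + i)) / (1 - Q ^ (i + 1))) * Q ^ k *
    (t ^ (k + j) * Q ^ (j * (n + 1))) *
    ∑ m ∈ Finset.range (k + 1), kernelPoch Q n t m * kernelProd Q n (Q ^ k) (Q ^ j) m

theorem berezinKernel_recurrence {Q t : ℂ} {n : ℕ} (hn : 1 ≤ n) (hQ : Q ≠ 0) (ht : t ≠ 0)
    (h1 : ∀ i : ℕ, 1 - Q ^ (i + 1) ≠ 0) (k j : ℕ) :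
    (1 - Q ^ (n + j)) * berezinKernel Q n k t (j + 1) =
      (t * Q ^ (n + 1) + 1 / (t * Q)) * berezinKernel Q n k t j
      - (1 - t * Q ^ (n + 1)) ^ 2 / (t * Q) * berezinKernel Q n k (t * Q) j
      - 2 * Q ^ (n + j) * berezinKernel Q n k t j
      - Q ^ n * (1 - Q ^ j) * berezinKernel Q n k t (j - 1) := by
  have h := kernel_sum_recurrence hn hQ ht h1 (Q ^ k) (Q ^ j) k
  have hprev : (1 - Q ^ j) * berezinKernel Q n k t (j - 1) =
      (∏ i ∈ Finset.range (n - 1), (1 - Q ^ (k + 1 + i)) / (1 - Q ^ (i + 1))) * Q ^ k *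
      (t ^ (k + j) * Q ^ (j * (n + 1))) * ((1 - Q ^ j) * (∑ m ∈ Finset.range (k + 1),
        kernelPoch Q n t m * kernelProd Q n (Q ^ k) (Q ^ j / Q) m) / (t * Q ^ (n + 1))) := by
    cases j with
    | zero => simp
    | succ j =>
      have hj : Q ^ (j + 1) / Q = Q ^ j := by rw [pow_succ, mul_div_cancel_right₀ _ hQ]
      rw [hj, Nat.add_sub_cancel, berezinKernel]
      field_simp
      ring
  rw [mul_assoc (Q ^ n) (1 - Q ^ j), hprev]
  simp only [berezinKernel]
  rw [div_self (pow_ne_zero k hQ), sub_self, mul_zero, zero_div, zero_mul, zero_mul, zero_mul,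
    neg_zero] at h
  set W := ∏ i ∈ Finset.range (n - 1), (1 - Q ^ (k + 1 + i)) / (1 - Q ^ (i + 1))
  have h' : (1 - Q ^ n * Q ^ j) * (t * Q ^ (n + 1) *
        ∑ m ∈ Finset.range (k + 1), kernelPoch Q n t m * kernelProd Q n (Q ^ k) (Q ^ (j + 1)) m)
      + 2 * (Q ^ n * Q ^ j) *
        ∑ m ∈ Finset.range (k + 1), kernelPoch Q n t m * kernelProd Q n (Q ^ k) (Q ^ j) m
      + Q ^ n * (1 - Q ^ j) / (t * Q ^ (n + 1)) *
        ∑ m ∈ Finset.range (k + 1), kernelPoch Q n t m * kernelProd Q n (Q ^ k) (Q ^ j / Q) m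
      - (t * Q ^ (n + 1) + 1 / (t * Q)) *
        ∑ m ∈ Finset.range (k + 1), kernelPoch Q n t m * kernelProd Q n (Q ^ k) (Q ^ j) m
      + Q ^ k * Q ^ j / (t * Q) * (1 - t * Q ^ (n + 1)) ^ 2 *
        ∑ m ∈ Finset.range (k + 1),
          kernelPoch Q n (t * Q) m * kernelProd Q n (Q ^ k) (Q ^ j) m = 0 := by
    rw [← h]
    simp only [Finset.mul_sum, ← Finset.sum_add_distrib, ← Finset.sum_sub_distrib]
    refine Finset.sum_congr rfl fun m _ => ?_
    rw [pow_succ Q j]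
    ring
  have e1 : t ^ (k + (j + 1)) * Q ^ ((j + 1) * (n + 1)) =
    t ^ (k + j) * Q ^ (j * (n + 1)) * (t * Q ^ (n + 1)) := by ring
  have e2 : (t * Q) ^ (k + j) * Q ^ (j * (n + 1)) =
    t ^ (k + j) * Q ^ (j * (n + 1)) * (Q ^ k * Q ^ j) := by ring
  rw [e1, e2, pow_add Q n j]
  linear_combination (W * Q ^ k * (t ^ (k + j) * Q ^ (j * (n + 1)))) * h'

theorem berezinKernel_zero {Q : ℂ} (n k : ℕ) (hQ : Q ≠ 0) (t : ℂ) :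
    berezinKernel Q n k t 0 = t ^ k * (Q ^ k *
      ∏ i ∈ Finset.range (n - 1), (1 - Q ^ (k + 1 + i)) / (1 - Q ^ (i + 1))) := by
  rw [berezinKernel, Finset.sum_eq_single_of_mem 0 (by simp)
    fun m _ hm => by rw [kernelProd_eq_zero_left n hQ _ (Nat.pos_of_ne_zero hm), mul_zero]]
  simp [kernelPoch, kernelProd]
  ring

/-- A double sequence solving the same three-term recurrence in both indices and starting from
`δ_k` has the Berezin kernel as generating function. -/
theorem hasSum_berezinKernel {Q : ℂ} {n : ℕ} (hn : 1 ≤ n) (hQ : Q ≠ 0)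
    (h1 : ∀ i : ℕ, 1 - Q ^ (i + 1) ≠ 0) (k : ℕ) (A : ℕ → ℕ → ℂ) (W : ℕ → ℂ)
    (hW : ∀ r, W (r + 1) * (1 - Q ^ (r + 1)) = Q * W r * (1 - Q ^ (n + r)))
    (hWk : W k = Q ^ k * ∏ i ∈ Finset.range (n - 1), (1 - Q ^ (k + 1 + i)) / (1 - Q ^ (i + 1)))
    (hA0 : ∀ r, A r 0 = if r = k then 1 else 0)
    (hA : ∀ r j, (1 - Q ^ (n + r)) * A (r + 1) j + 2 * Q ^ (n + r) * A r j
        + Q ^ n * (1 - Q ^ r) * A (r - 1) j =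
      (1 - Q ^ (n + j)) * A r (j + 1) + 2 * Q ^ (n + j) * A r j
        + Q ^ n * (1 - Q ^ j) * A r (j - 1)) (j : ℕ) :
    ∀ t : ℂ, t ≠ 0 → HasSum (fun r => t ^ r * W r * A r j) (berezinKernel Q n k t j) := by
  induction j using Nat.strong_induction_on with
  | _ j ih =>
  intro t ht
  cases j with
  | zero =>
    have h := hasSum_single (f := fun r => t ^ r * W r * A r 0) k
      fun r hr => by simp [hA0, hr]
    simpa [hA0, berezinKernel_zero n k hQ, hWk] using h
  | succ j =>
    have hj := ih j (Nat.lt_succ_self j)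
    have hS := hj t ht
    have hSQ := hj (t * Q) (mul_ne_zero ht hQ)
    have hprev := (ih (j - 1) (by omega) t ht).mul_left (Q ^ n * (1 - Q ^ j))
    have hup : HasSum (fun r => t ^ r * W r * ((1 - Q ^ (n + r)) * A (r + 1) j))
        (1 / (t * Q) * (berezinKernel Q n k t j - berezinKernel Q n k (t * Q) j)) := by
      have h := (hS.sub hSQ).mul_left (1 / (t * Q))
      rw [← hasSum_nat_add_iff' 1] at h
      simp only [Finset.sum_range_one, pow_zero, sub_self, mul_zero, sub_zero] at h
      refine h.congr_fun fun r => ?_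
      have := hW r
      field_simp
      linear_combination (-(t ^ (r + 1) * A (r + 1) j)) * this
    have hdown : HasSum (fun r => t ^ r * W r * (Q ^ n * (1 - Q ^ r) * A (r - 1) j))
        (Q ^ (n + 1) * t * (berezinKernel Q n k t j
          - Q ^ n * berezinKernel Q n k (t * Q) j)) := by
      rw [← hasSum_nat_add_iff' 1]
      simp only [Finset.sum_range_one, pow_zero, sub_self, mul_zero, zero_mul, sub_zero]
      refine ((hS.sub (hSQ.mul_left (Q ^ n))).mul_left (Q ^ (n + 1) * t)).congr_fun fun r => ?_
      rw [Nat.add_sub_cancel]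
      linear_combination (t ^ (r + 1) * Q ^ n * A r j) * hW r
    have hne : 1 - Q ^ (n + j) ≠ 0 := by
      obtain ⟨n, rfl⟩ := Nat.exists_eq_add_of_le' hn
      rw [show n + 1 + j = n + j + 1 by ring]
      exact h1 _
    have htot := ((((hup.add (hSQ.mul_left (2 * Q ^ n))).add hdown).sub
      (hS.mul_left (2 * Q ^ (n + j)))).sub hprev).mul_left (1 - Q ^ (n + j))⁻¹
    have hlim : berezinKernel Q n k t (j + 1) = (1 - Q ^ (n + j))⁻¹ *
        (1 / (t * Q) * (berezinKernel Q n k t j - berezinKernel Q n k (t * Q) j)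
        + 2 * Q ^ n * berezinKernel Q n k (t * Q) j
        + Q ^ (n + 1) * t * (berezinKernel Q n k t j - Q ^ n * berezinKernel Q n k (t * Q) j)
        - 2 * Q ^ (n + j) * berezinKernel Q n k t j
        - Q ^ n * (1 - Q ^ j) * berezinKernel Q n k t (j - 1)) := by
      rw [← mul_right_inj' hne, mul_inv_cancel_left₀ hne, berezinKernel_recurrence hn hQ ht h1]
      field_simp
      ring
    rw [hlim]
    refine htot.congr_fun fun r => ?_
    rw [← mul_right_inj' hne, mul_inv_cancel_left₀ hne]
    linear_combination (-(t ^ r * W r)) * hA r j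

theorem qpochC_eq (q : ℝ) (a : ℂ) (m : ℕ) :
    qpochC q a m = ∏ i ∈ Finset.range m, (1 - a * ((q : ℂ) ^ 2) ^ i) := by
  simp only [qpochC, pow_mul]

theorem ofReal_qpochR (q a : ℝ) (m : ℕ) : ((qpochR q a m : ℝ) : ℂ) = qpochC q a m := by
  simp [qpochR, qpochC]

theorem eval_pBerPoly {q : ℝ} (hq : q ≠ 0) {n : ℕ} (hn : 1 ≤ n) (x : ℂ) {r N : ℕ} (hN : r < N) :
    (pBerPoly q n r).eval x = ∑ l ∈ Finset.range N,
      seriesCoeff ((q : ℂ) ^ 2) n (((q : ℂ) ^ 2) ^ r) l *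
        seriesBasis ((q : ℂ) ^ 2) n
          (1 + ((q : ℂ) ^ 2) ^ n + ((q : ℂ) ^ 2) ^ (n - 1) * (1 - (q : ℂ) ^ 2) ^ 2 * x) l := by
  have hQ : (q : ℂ) ^ 2 ≠ 0 := pow_ne_zero 2 (Complex.ofReal_ne_zero.2 hq)
  rw [pBerPoly, Polynomial.eval_finsetSum]
  rw [← Finset.sum_subset (Finset.range_mono (Nat.succ_le_of_lt hN)) fun l _ hl => by
    rw [seriesCoeff_eq_zero n hQ (by simpa using hl), zero_mul]]
  refine Finset.sum_congr rfl fun l _ => ?_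
  rw [Polynomial.eval_mul, Polynomial.eval_C, Polynomial.eval_prod]
  congr 1
  · rw [qpochC_eq, qpochC_eq, qpochC_eq, seriesCoeff, Finset.prod_div_distrib,
      Finset.prod_mul_distrib, Finset.prod_mul_distrib, Finset.prod_const, Finset.card_range]
    simp only [← pow_mul, pow_add, div_eq_inv_mul, mul_comm, one_mul]
  · refine Finset.prod_congr rfl fun m _ => ?_
    obtain ⟨n, rfl⟩ := Nat.exists_eq_add_of_le' hn
    rw [show 2 * m + 2 * (n + 1) - 2 = 2 * m + 2 * n by omega, Nat.add_sub_cancel]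
    simp
    ring

theorem pBerPoly_recurrence {q : ℝ} (hq : q ≠ 0) {n : ℕ} (hn : 1 ≤ n)
    (h1 : ∀ i : ℕ, 1 - ((q : ℂ) ^ 2) ^ (i + 1) ≠ 0) (r : ℕ) :
    pBerPoly q n r * (Polynomial.C (1 + ((q : ℂ) ^ 2) ^ n) +
      Polynomial.C (((q : ℂ) ^ 2) ^ (n - 1) * (1 - (q : ℂ) ^ 2) ^ 2) * Polynomial.X) =
    Polynomial.C (1 - ((q : ℂ) ^ 2) ^ (n + r)) * pBerPoly q n (r + 1)
      + Polynomial.C (2 * ((q : ℂ) ^ 2) ^ (n + r)) * pBerPoly q n r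
      + Polynomial.C (((q : ℂ) ^ 2) ^ n * (1 - ((q : ℂ) ^ 2) ^ r)) * pBerPoly q n (r - 1) := by
  have hQ : (q : ℂ) ^ 2 ≠ 0 := pow_ne_zero 2 (Complex.ofReal_ne_zero.2 hq)
  refine Polynomial.funext fun x => ?_
  simp only [Polynomial.eval_add, Polynomial.eval_mul, Polynomial.eval_C, Polynomial.eval_X]
  rw [eval_pBerPoly hq hn x (show r < r + 2 by omega),
    eval_pBerPoly hq hn x (show r + 1 < r + 2 by omega),
    eval_pBerPoly hq hn x (show r - 1 < r + 2 by omega)]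
  set Q := (q : ℂ) ^ 2
  set y := 1 + Q ^ n + Q ^ (n - 1) * (1 - Q) ^ 2 * x
  have h := sum_series_recurrence hn hQ (pow_ne_zero r hQ) h1 y (r + 1)
  rw [seriesCoeff_eq_zero n hQ (Nat.lt_succ_self r), zero_mul, zero_div, neg_zero] at h
  have hprev : ∀ l, (1 - Q ^ r) * seriesCoeff Q n (Q ^ r / Q) l =
      (1 - Q ^ r) * seriesCoeff Q n (Q ^ (r - 1)) l := by
    intro l
    cases r with
    | zero => simp
    | succ r => rw [pow_succ, mul_div_cancel_right₀ _ hQ, Nat.add_sub_cancel]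
  simp only [hprev, ← pow_succ] at h
  rw [← sub_eq_zero, ← h]
  simp only [Finset.mul_sum, Finset.sum_mul, ← Finset.sum_add_distrib, ← Finset.sum_sub_distrib]
  refine Finset.sum_congr rfl fun l _ => ?_
  rw [pow_add]
  ring

theorem aeval_DeltaOp_affine {q : ℝ} (hq : q ≠ 0) (h : 1 - (q : ℂ) ^ 2 ≠ 0) {n : ℕ} (hn : 1 ≤ n)
    (g : ℕ → ℂ) (j : ℕ) :
    Polynomial.aeval (DeltaOp q n) (Polynomial.C (1 + ((q : ℂ) ^ 2) ^ n) +
      Polynomial.C (((q : ℂ) ^ 2) ^ (n - 1) * (1 - (q : ℂ) ^ 2) ^ 2) * Polynomial.X) g j =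
    (1 - ((q : ℂ) ^ 2) ^ (n + j)) * g (j + 1) + 2 * ((q : ℂ) ^ 2) ^ (n + j) * g j
      + ((q : ℂ) ^ 2) ^ n * (1 - ((q : ℂ) ^ 2) ^ j) * g (j - 1) := by
  have hq' : (q : ℂ) ≠ 0 := Complex.ofReal_ne_zero.2 hq
  simp only [map_add, map_mul, Polynomial.aeval_C, Polynomial.aeval_X, LinearMap.add_apply,
    Module.End.mul_apply, Module.algebraMap_end_apply, Pi.add_apply, Pi.smul_apply, smul_eq_mul,
    DeltaOp, LinearMap.coe_mk, AddHom.coe_mk]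
  obtain ⟨n, rfl⟩ := Nat.exists_eq_add_of_le' hn
  have hif : (1 - (q : ℂ) ^ (2 * j)) * (if j = 0 then 0 else g (j - 1)) =
      (1 - (q : ℂ) ^ (2 * j)) * g (j - 1) := by
    split_ifs with h0 <;> simp [h0]
  rw [hif, Nat.add_sub_cancel]
  field_simp
  ring

theorem aeval_pBerPoly_recurrence {q : ℝ} (hq : q ≠ 0) {n : ℕ} (hn : 1 ≤ n)
    (h1 : ∀ i : ℕ, 1 - ((q : ℂ) ^ 2) ^ (i + 1) ≠ 0) (r : ℕ) (g : ℕ → ℂ) (j : ℕ) :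
    (1 - ((q : ℂ) ^ 2) ^ (n + r)) * Polynomial.aeval (DeltaOp q n) (pBerPoly q n (r + 1)) g j
      + 2 * ((q : ℂ) ^ 2) ^ (n + r) * Polynomial.aeval (DeltaOp q n) (pBerPoly q n r) g j
      + ((q : ℂ) ^ 2) ^ n * (1 - ((q : ℂ) ^ 2) ^ r) *
        Polynomial.aeval (DeltaOp q n) (pBerPoly q n (r - 1)) g j =
    Polynomial.aeval (DeltaOp q n) (pBerPoly q n r * (Polynomial.C (1 + ((q : ℂ) ^ 2) ^ n) +
      Polynomial.C (((q : ℂ) ^ 2) ^ (n - 1) * (1 - (q : ℂ) ^ 2) ^ 2) * Polynomial.X)) g j := by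
  rw [pBerPoly_recurrence hq hn h1, map_add, map_add,
    map_mul (Polynomial.aeval (DeltaOp q n)), map_mul (Polynomial.aeval (DeltaOp q n)),
    map_mul (Polynomial.aeval (DeltaOp q n))]
  simp only [Polynomial.aeval_C, LinearMap.add_apply, Module.End.mul_apply,
    Module.algebraMap_end_apply, Pi.add_apply,
    Pi.smul_apply, smul_eq_mul]

theorem aeval_pBerPoly_apply_zero {q : ℝ} (hq : q ≠ 0) {n : ℕ} (hn : 1 ≤ n)
    (h1 : ∀ i : ℕ, 1 - ((q : ℂ) ^ 2) ^ (i + 1) ≠ 0) (r : ℕ) :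
    ∀ g : ℕ → ℂ, Polynomial.aeval (DeltaOp q n) (pBerPoly q n r) g 0 = g r := by
  induction r using Nat.strong_induction_on with
  | _ r ih =>
  intro g
  cases r with
  | zero => simp [pBerPoly, qpochC]
  | succ r =>
    have h := aeval_pBerPoly_recurrence hq hn h1 r g 0
    rw [map_mul, Module.End.mul_apply, ih r (Nat.lt_succ_self r), ih r (Nat.lt_succ_self r),
      ih (r - 1) (by omega), aeval_DeltaOp_affine hq (by simpa using h1 0) hn] at h
    have hne : 1 - ((q : ℂ) ^ 2) ^ (n + r) ≠ 0 := by
      obtain ⟨n, rfl⟩ := Nat.exists_eq_add_of_le' hn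
      rw [show n + 1 + r = n + r + 1 by ring]
      exact h1 _
    refine mul_left_cancel₀ hne ?_
    linear_combination h

theorem prod_one_sub_pow_reflect {Q : ℂ} (hQ : Q ≠ 0) {m j : ℕ} (h : m ≤ j) :
    ∏ i ∈ Finset.range m, (1 - Q ^ (j - m + 1 + i)) =
      ∏ i ∈ Finset.range m, (1 - Q ^ j / Q ^ i) := by
  rw [← Finset.prod_range_reflect]
  refine Finset.prod_congr rfl fun i hi => ?_
  have hi := Finset.mem_range.1 hi
  rw [show j - m + 1 + (m - 1 - i) = j - i by omega, pow_sub₀ _ hQ (by omega), div_eq_mul_inv]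

theorem ofReal_Brad {q : ℝ} (hq : q ≠ 0) (t : ℝ) {n : ℕ} (hn : 1 ≤ n) (k j : ℕ) :
    (Brad q t n k j : ℂ) =
      qpochC q ((q : ℂ) ^ 2 * (t : ℂ)) n * berezinKernel ((q : ℂ) ^ 2) n k t j := by
  have hQ : (q : ℂ) ^ 2 ≠ 0 := pow_ne_zero 2 (Complex.ofReal_ne_zero.2 hq)
  have hsub : Finset.range (min j k + 1) ⊆ Finset.range (k + 1) :=
    Finset.range_mono (by omega)
  rw [berezinKernel, ← Finset.sum_subset hsub fun m hm hm' => by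
    rw [kernelProd_eq_zero_left n hQ _ (by simp at hm hm'; omega), mul_zero]]
  simp only [Brad, Complex.ofReal_mul, Complex.ofReal_sum, Finset.mul_sum, Complex.ofReal_div,
    Complex.ofReal_inv, Complex.ofReal_pow, ofReal_qpochR]
  refine Finset.sum_congr rfl fun m hm => ?_
  have hm := Finset.mem_range.1 hm
  obtain ⟨n, rfl⟩ := Nat.exists_eq_add_of_le' hn
  have hk : (q : ℂ) ^ (2 * k - 2 * m + 2) = ((q : ℂ) ^ 2) ^ (k - m + 1) := by
    rw [← pow_mul]; congr 1; omega
  have hj : (q : ℂ) ^ (2 * j - 2 * m + 2) = ((q : ℂ) ^ 2) ^ (j - m + 1) := by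
    rw [← pow_mul]; congr 1; omega
  have ht : (q : ℂ) ^ (2 * (n + 1) + 2) = ((q : ℂ) ^ 2) ^ (n + 1 + 1) := by
    rw [← pow_mul]; ring
  rw [hk, hj, ht, show n + 1 + m - 1 = m + n by omega, Nat.add_sub_cancel]
  simp only [qpochC_eq, pow_mul (q : ℂ) 2]
  set Q := (q : ℂ) ^ 2
  have p1 : ∏ i ∈ Finset.range (n + 1 + m), (1 - (t : ℂ) * Q * Q ^ i) =
      (∏ i ∈ Finset.range (n + 1), (1 - Q * t * Q ^ i)) *
        ∏ i ∈ Finset.range m, (1 - t * Q ^ (n + 1 + 1 + i)) := by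
    rw [Finset.prod_range_add]
    congr 1 <;> refine Finset.prod_congr rfl fun i _ => by ring
  have p2 : ∏ i ∈ Finset.range (m + n), (1 - Q ^ (k - m + 1) * Q ^ i) =
      (∏ i ∈ Finset.range m, (1 - Q ^ k / Q ^ i)) *
        ∏ i ∈ Finset.range n, (1 - Q ^ (k + 1 + i)) := by
    rw [Finset.prod_range_add, ← prod_one_sub_pow_reflect hQ (show m ≤ k by omega)]
    congr 1 <;> refine Finset.prod_congr rfl fun i _ => ?_
    · rw [pow_add _ _ i]
    · rw [← pow_add, show k - m + 1 + (m + i) = k + 1 + i by omega]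
  have p3 : ∏ i ∈ Finset.range m, (1 - Q ^ (j - m + 1) * Q ^ i) =
      ∏ i ∈ Finset.range m, (1 - Q ^ j / Q ^ i) := by
    rw [← prod_one_sub_pow_reflect hQ (show m ≤ j by omega)]
    simp only [pow_add]
  have p4 : ∏ i ∈ Finset.range (m + n), (1 - Q * Q ^ i) =
      (∏ i ∈ Finset.range n, (1 - Q ^ (i + 1))) *
        ∏ i ∈ Finset.range m, (1 - Q ^ (n + 1 + i)) := by
    rw [add_comm m n, Finset.prod_range_add]
    congr 1 <;> refine Finset.prod_congr rfl fun i _ => by ring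
  have p5 : ∏ i ∈ Finset.range m, (1 - (t : ℂ) * Q ^ (n + 1 + 1) * Q ^ i) =
      ∏ i ∈ Finset.range m, (1 - t * Q ^ (n + 1 + 1 + i)) :=
    Finset.prod_congr rfl fun i _ => by ring
  have p6 : ∏ i ∈ Finset.range m, (1 - Q * Q ^ i) = ∏ i ∈ Finset.range m, (1 - Q ^ (i + 1)) :=
    Finset.prod_congr rfl fun i _ => by ring
  rw [p1, p2, p3, p4, p5, p6, kernelPoch, kernelProd]
  simp only [Finset.prod_div_distrib, Finset.prod_mul_distrib, Finset.prod_const,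
    Finset.card_range]
  have p7 : (q : ℂ) ^ (4 * m + 2 * m * (n + 1)) = (Q ^ (n + 1 + 2)) ^ m := by
    simp only [Q, ← pow_mul]; ring
  rw [p7, show (q : ℂ) ^ (2 * j * (n + 1 + 1)) = Q ^ (j * (n + 1 + 1)) by
    rw [← pow_mul, mul_assoc]]
  simp only [div_eq_mul_inv, mul_inv]
  ring

/-- Proposition 5.5 (radial case): the asymptotic expansion
`(B_{q,t} f_k)(q^{2j}) = (q²t;q²)_n Σ_{r≥0} t^r q^{2r} (q^{2r+2};q²)_{n−1}/(q²;q²)_{n−1}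
· (p_r(Δ) δ_k)(j)`, the series converging absolutely. -/
theorem statement19 (q : ℝ) (hq0 : 0 < q) (hq1 : q < 1) (n : ℕ) (hn : 1 ≤ n)
    (j k : ℕ) (t : ℝ) (ht0 : 0 < t) (ht1 : t < 1) :
    Summable (fun r : ℕ => ‖(t : ℂ) ^ r * (q : ℂ) ^ (2 * r) *
      (qpochC q ((q : ℂ) ^ (2 * r + 2)) (n - 1) / qpochC q ((q : ℂ) ^ 2) (n - 1)) *
      ((Polynomial.aeval (DeltaOp q n) (pBerPoly q n r))
        (fun l => if l = k then (1 : ℂ) else 0) j)‖) ∧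
    (Brad q t n k j : ℂ) =
      qpochC q ((q : ℂ) ^ 2 * (t : ℂ)) n *
        ∑' r : ℕ, (t : ℂ) ^ r * (q : ℂ) ^ (2 * r) *
          (qpochC q ((q : ℂ) ^ (2 * r + 2)) (n - 1) / qpochC q ((q : ℂ) ^ 2) (n - 1)) *
          ((Polynomial.aeval (DeltaOp q n) (pBerPoly q n r))
            (fun l => if l = k then (1 : ℂ) else 0) j) := by
  have h1 : ∀ i : ℕ, 1 - ((q : ℂ) ^ 2) ^ (i + 1) ≠ 0 := by
    intro i h
    have h' : (1 : ℝ) - (q ^ 2) ^ (i + 1) = 0 := by exact_mod_cast h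
    have : (q ^ 2) ^ (i + 1) < 1 := pow_lt_one₀ (by positivity) (by nlinarith) (by omega)
    linarith
  have hQ : (q : ℂ) ^ 2 ≠ 0 := pow_ne_zero 2 (Complex.ofReal_ne_zero.2 hq0.ne')
  have hratio : ∀ r : ℕ,
      qpochC q ((q : ℂ) ^ (2 * r + 2)) (n - 1) / qpochC q ((q : ℂ) ^ 2) (n - 1) =
      ∏ i ∈ Finset.range (n - 1),
        (1 - ((q : ℂ) ^ 2) ^ (r + 1 + i)) / (1 - ((q : ℂ) ^ 2) ^ (i + 1)) := by
    intro r
    rw [qpochC_eq, qpochC_eq, ← Finset.prod_div_distrib]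
    refine Finset.prod_congr rfl fun i _ => ?_
    congr 1 <;> ring
  have hsum := hasSum_berezinKernel hn hQ h1 k
    (fun r j => Polynomial.aeval (DeltaOp q n) (pBerPoly q n r)
      (fun l => if l = k then (1 : ℂ) else 0) j)
    (fun r => ((q : ℂ) ^ 2) ^ r * ∏ i ∈ Finset.range (n - 1),
        (1 - ((q : ℂ) ^ 2) ^ (r + 1 + i)) / (1 - ((q : ℂ) ^ 2) ^ (i + 1)))
    (fun r => by
      obtain ⟨n, rfl⟩ := Nat.exists_eq_add_of_le' hn
      have h2 := Finset.prod_range_succ' (fun i => 1 - ((q : ℂ) ^ 2) ^ (r + 1 + i)) n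
      rw [Finset.prod_range_succ] at h2
      simp only [Nat.add_sub_cancel, Finset.prod_div_distrib, pow_succ ((q : ℂ) ^ 2) r]
      simp only [add_zero, ← add_assoc, add_right_comm _ _ 1] at h2 ⊢
      rw [show n + 1 + r = r + 1 + n by ring]
      linear_combination (-(((q : ℂ) ^ 2) ^ r * (q : ℂ) ^ 2 *
        (∏ i ∈ Finset.range n, (1 - ((q : ℂ) ^ 2) ^ (i + 1)))⁻¹)) * h2)
    rfl
    (fun r => aeval_pBerPoly_apply_zero hq0.ne' hn h1 r _)
    (fun r j => by
      rw [aeval_pBerPoly_recurrence hq0.ne' hn h1, mul_comm, map_mul, Module.End.mul_apply,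
        aeval_DeltaOp_affine hq0.ne' (by simpa using h1 0) hn])
    j t (Complex.ofReal_ne_zero.2 ht0.ne')
  have hterm : ∀ r : ℕ, (t : ℂ) ^ r * (q : ℂ) ^ (2 * r) *
      (qpochC q ((q : ℂ) ^ (2 * r + 2)) (n - 1) / qpochC q ((q : ℂ) ^ 2) (n - 1)) =
      (t : ℂ) ^ r * (((q : ℂ) ^ 2) ^ r * ∏ i ∈ Finset.range (n - 1),
        (1 - ((q : ℂ) ^ 2) ^ (r + 1 + i)) / (1 - ((q : ℂ) ^ 2) ^ (i + 1))) := fun r => by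
    rw [hratio, pow_mul, mul_assoc]
  simp only [hterm]
  exact ⟨hsum.summable.norm, by rw [hsum.tsum_eq, ofReal_Brad hq0.ne' t hn]⟩
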